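/- Let k ≥ 1. Any connected k-extendable graph of order 2k+2 is isomorphic either to the complete graph K_{2k+2} or to the complete bipartite graph K_{k+1,k+1}. -/

import Mathlib

open SimpleGraph

/-- A set of edges of `G` forming a matching: pairwise disjoint edges of `G`. -/
def IsMatchingSet {V : Type*} (G : SimpleGraph V) (M : Set (Sym2 V)) : Prop :=
  M ⊆ G.edgeSet ∧ M.Pairwise fun e f => ∀ v, v ∈ e → v ∉ f

/-- A perfect matching of `G`: a matching covering every vertex. -/
def IsPerfectMatchingSet {V : Type*} (G : SimpleGraph V) (M : Set (Sym2 V)) : Prop :=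
  IsMatchingSet G M ∧ ∀ v : V, ∃ e ∈ M, v ∈ e

/-- `G` is `k`-extendable: it has a perfect matching, and every `k`-matching
extends to a perfect matching. -/
def Extendable {V : Type*} (G : SimpleGraph V) (k : ℕ) : Prop :=
  (∃ P, IsPerfectMatchingSet G P) ∧
    ∀ M : Set (Sym2 V), IsMatchingSet G M → M.ncard = k →
      ∃ P, IsPerfectMatchingSet G P ∧ M ⊆ P

/-- A perfect matching of `G`, given as the involution exchanging matched vertices. -/
structure IsMatchingInvolution {V : Type*} (G : SimpleGraph V) (σ : V → V) : Prop where
  involutive : ∀ x, σ (σ x) = x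
  adj : ∀ x, G.Adj x (σ x)

/-- The involution obtained from `σ` by matching `a` with `c` and `σ a` with `σ c`. -/
noncomputable def rematch {V : Type*} (σ : V → V) (a c : V) : V → V :=
  open Classical in fun t =>
    if t = a then c else if t = c then a
    else if t = σ a then σ c else if t = σ c then σ a else σ t

/-- If `{a, σ a}` and `{c, σ c}` are edges of a perfect matching and `a` is adjacent to `c`,
then `σ a` is adjacent to `σ c`. -/
def HasExchange {V : Type*} (G : SimpleGraph V) : Prop :=
  ∀ σ, IsMatchingInvolution G σ → ∀ a c, G.Adj a c → G.Adj (σ a) (σ c)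

section

variable {V : Type*} {G : SimpleGraph V}

theorem IsMatchingSet.eq_of_mem {M : Set (Sym2 V)} (hM : IsMatchingSet G M) {e f : Sym2 V}
    (he : e ∈ M) (hf : f ∈ M) {v : V} (hve : v ∈ e) (hvf : v ∈ f) : e = f := by
  by_contra hne
  exact hM.2 he hf hne v hve hvf

theorem IsPerfectMatchingSet.exists_involution {P : Set (Sym2 V)}
    (hP : IsPerfectMatchingSet G P) : ∃ σ, IsMatchingInvolution G σ := by
  have h : ∀ v, ∃ w, s(v, w) ∈ P := by
    intro v
    obtain ⟨e, he, hve⟩ := hP.2 v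
    obtain ⟨w, rfl⟩ := hve
    exact ⟨w, he⟩
  choose σ hσ using h
  refine ⟨σ, fun x => ?_, fun x => hP.1.1 (hσ x)⟩
  have := hP.1.eq_of_mem (hσ x) (hσ (σ x)) (v := σ x) (by simp) (by simp)
  rw [Sym2.eq_swap, Sym2.congr_right] at this
  exact this.symm

/-- An involution with exactly two fixed points, all of whose other orbits are edges,
encodes a `k`-matching missing two vertices; by extendability these are adjacent. -/
theorem Extendable.adj_of_fixed [Fintype V] {k : ℕ} (hext : Extendable G k)
    (hcard : Fintype.card V = 2 * k + 2) {τ : V → V} {u v : V} (huv : u ≠ v)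
    (hinv : ∀ x, τ (τ x) = x) (hu : τ u = u) (hv : τ v = v)
    (hadj : ∀ x, x ≠ u → x ≠ v → G.Adj x (τ x)) : G.Adj u v := by
  classical
  set S : Finset V := {u, v}ᶜ with hS
  have hScard : S.card = 2 * k := by
    rw [hS, Finset.card_compl, hcard, Finset.card_pair huv]; omega
  have hmem : ∀ x, x ∈ S ↔ x ≠ u ∧ x ≠ v := by intro x; simp [hS]
  set M : Finset (Sym2 V) := S.image fun x => s(x, τ x) with hM
  have hMcard : M.card = k := by
    have h := Finset.card_eq_sum_card_image (fun x => s(x, τ x)) S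
    have h2 : ∀ e ∈ M, (S.filter fun x => s(x, τ x) = e).card = 2 := by
      intro e he
      obtain ⟨x, hx, rfl⟩ := Finset.mem_image.1 he
      have : (S.filter fun y => s(y, τ y) = s(x, τ x)) = {x, τ x} := by
        ext y
        simp only [Finset.mem_filter, hmem, Sym2.eq_iff, Finset.mem_insert,
          Finset.mem_singleton] at hx ⊢
        grind
      rw [this, Finset.card_pair]
      exact (hadj x ((hmem x).1 hx).1 ((hmem x).1 hx).2).ne
    rw [Finset.sum_congr rfl h2, Finset.sum_const, smul_eq_mul] at h
    change S.card = M.card * 2 at h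
    omega
  have hmatch : IsMatchingSet G (M : Set (Sym2 V)) := by
    constructor
    · intro e he
      obtain ⟨x, hx, rfl⟩ := Finset.mem_image.1 (Finset.mem_coe.1 he)
      exact hadj x ((hmem x).1 hx).1 ((hmem x).1 hx).2
    · intro e he f hf hne w hwe hwf
      obtain ⟨x, hx, rfl⟩ := Finset.mem_image.1 (Finset.mem_coe.1 he)
      obtain ⟨y, hy, rfl⟩ := Finset.mem_image.1 (Finset.mem_coe.1 hf)
      rw [Sym2.mem_iff] at hwe hwf
      rw [Ne, Sym2.eq_iff] at hne
      grind
  obtain ⟨P, hP, hMP⟩ := hext.2 M hmatch (by rw [Set.ncard_coe_finset, hMcard])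
  obtain ⟨e, he, hue⟩ := hP.2 u
  obtain ⟨w, rfl⟩ := hue
  have huw : G.Adj u w := hP.1.1 he
  by_cases hwv : w = v
  · exact hwv ▸ huw
  · have hw : s(w, τ w) ∈ P :=
      hMP (Finset.mem_coe.2 (Finset.mem_image_of_mem _ ((hmem w).2 ⟨huw.ne', hwv⟩)))
    have := hP.1.eq_of_mem he hw (v := w) (by simp) (by simp)
    rw [Sym2.eq_iff] at this
    have hne := huw.ne
    grind

theorem Extendable.hasExchange [Fintype V] {k : ℕ} (hext : Extendable G k)
    (hcard : Fintype.card V = 2 * k + 2) : HasExchange G := by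
  classical
  intro σ hσ a c hac
  have hinv := hσ.involutive
  by_cases hc : c = σ a
  · rw [hc]; exact hσ.adj (σ a)
  have hne := hac.ne
  have hnf : ∀ x, σ x ≠ x := fun x => (hσ.adj x).ne'
  refine hext.adj_of_fixed hcard (τ := fun t => if t = a then c else if t = c then a
    else if t = σ a then t else if t = σ c then t else σ t) ?_ ?_ ?_ ?_ ?_
  · grind
  · intro x; grind
  · grind
  · grind
  · intro x hx hx'
    have := hσ.adj x
    have := hac.symm
    grind

namespace IsMatchingInvolution

variable {σ : V → V}

theorem rematch_of_adj (hσ : IsMatchingInvolution G σ) (hG : HasExchange G) {a c : V}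
    (hac : G.Adj a c) : IsMatchingInvolution G (rematch σ a c) := by
  have hinv := hσ.involutive
  have h := hG σ hσ a c hac
  have hne := hac.ne
  have hnf : ∀ x, σ x ≠ x := fun x => (hσ.adj x).ne'
  constructor
  · intro x
    unfold rematch
    grind
  · intro x
    have := hσ.adj x
    have := hac.symm
    have := h.symm
    unfold rematch
    grind

theorem adj_trans (hσ : IsMatchingInvolution G σ) (hG : HasExchange G) {u y w : V}
    (huy : G.Adj u (σ y)) (hyw : G.Adj y w) (hwu : w ≠ u) : G.Adj u w := by
  have hinv := hσ.involutive
  have h1 := hG _ (hσ.rematch_of_adj hG huy) _ _ hyw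
  have h2 := fun h => hG σ hσ (σ u) (σ w) h
  have := hσ.adj u
  have := hyw.ne
  have := (hσ.adj y).ne
  unfold rematch at h1
  grind

theorem adj_or_adj (hσ : IsMatchingInvolution G σ) (hG : HasExchange G) (hconn : G.Connected)
    (u y : V) : G.Adj u y ∨ G.Adj u (σ y) := by
  have hinv := hσ.involutive
  have hstep : ∀ y w, G.Adj y w → (G.Adj u y ∨ G.Adj u (σ y)) →
      (G.Adj u w ∨ G.Adj u (σ w)) := by
    intro y w hyw h
    by_cases hwu : w = u
    · subst hwu; exact Or.inr (hσ.adj w)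
    by_cases hwu' : σ w = u
    · left
      have := hσ.adj w
      rw [hwu'] at this
      exact this.symm
    rcases h with h | h
    · right
      refine hσ.adj_trans hG (y := σ y) ?_ (hG σ hσ _ _ hyw) hwu'
      rwa [hinv]
    · exact Or.inl (hσ.adj_trans hG h hyw hwu)
  obtain ⟨p⟩ := hconn.preconnected y u
  induction p with
  | nil => exact Or.inr (hσ.adj _)
  | cons h p ih => exact hstep _ _ h.symm (ih hstep)

theorem adj_of_ne (hσ : IsMatchingInvolution G σ) (hG : HasExchange G) (hconn : G.Connected)
    {x y : V} (hyx : y ≠ σ x) (h : G.Adj x y) (h' : G.Adj x (σ y)) {z : V}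
    (hzx : z ≠ x) : G.Adj z x := by
  have hinv := hσ.involutive
  by_contra hcon
  have hσ₁ := hσ.rematch_of_adj hG h
  have hσ₂ := hσ.rematch_of_adj hG h'
  have h1 : ¬ G.Adj (σ z) (σ x) := fun hz => hcon (by simpa [hinv] using hG σ hσ _ _ hz)
  have h2 := hG _ hσ₁ (σ z) y
  have h3 := hσ₂.adj_or_adj hG hconn (σ z) y
  have := h.ne
  have := h'.ne
  have := h.symm
  have := h'.symm
  have := (hσ.adj x).symm
  have := (hσ.adj y).ne
  unfold rematch at h2 h3
  grind

end IsMatchingInvolution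

end

/-- for `k ≥ 1`, any connected `k`-extendable graph of order `2k + 2`
is isomorphic to the complete graph `K_{2k+2}` or to the complete bipartite graph
`K_{k+1,k+1}`. -/
theorem connected_extendable_order_eq_two_k_add_two {V : Type*} [Fintype V]
    (G : SimpleGraph V) (k : ℕ) (hk : 1 ≤ k)
    (hconn : G.Connected) (hext : Extendable G k) (hcard : Fintype.card V = 2 * k + 2) :
    Nonempty (G ≃g (⊤ : SimpleGraph (Fin (2 * k + 2)))) ∨
    Nonempty (G ≃g completeBipartiteGraph (Fin (k + 1)) (Fin (k + 1))) := by
  classical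
  have hG := hext.hasExchange hcard
  obtain ⟨P, hP⟩ := hext.1
  obtain ⟨σ, hσ⟩ := hP.exists_involution
  have hinv := hσ.involutive
  have hor := hσ.adj_or_adj hG hconn
  by_cases hK : ∃ x y, y ≠ σ x ∧ G.Adj x y ∧ G.Adj x (σ y)
  · left
    obtain ⟨x, y, hyx, h, h'⟩ := hK
    have hx : ∀ z, z ≠ x → G.Adj z x := fun z hz => hσ.adj_of_ne hG hconn hyx h h' hz
    have hsx : ∀ z, z ≠ σ x → G.Adj z (σ x) := by
      refine fun z hz => hσ.adj_of_ne hG hconn (x := σ x) (y := y) ?_ ?_ (hG σ hσ _ _ h) hz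
      · rw [hinv]; exact h.ne'
      · simpa [hinv] using hG σ hσ _ _ h'
    have hall : ∀ z w, w ≠ z → G.Adj w z := by
      intro z w hwz
      by_cases hzx : z = x
      · exact hzx ▸ hx w (hzx ▸ hwz)
      by_cases hzx' : z = σ x
      · exact hzx' ▸ hsx w (hzx' ▸ hwz)
      refine hσ.adj_of_ne hG hconn (y := x) ?_ (hx z hzx) (hsx z hzx') hwz
      rintro rfl
      exact hzx' (hinv z).symm
    obtain rfl : G = ⊤ := by
      ext a b
      exact ⟨fun h => h.ne, fun h => hall b a h⟩
    exact ⟨Iso.completeGraph (Fintype.equivFinOfCardEq hcard)⟩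
  · right
    push Not at hK
    have hxor : ∀ x y, G.Adj x (σ y) ↔ ¬ G.Adj x y := by
      intro x y
      refine ⟨fun h h' => ?_, fun h => (hor x y).resolve_left h⟩
      by_cases hyx : y = σ x
      · rw [hyx, hinv] at h
        exact G.loopless.irrefl _ h
      · exact hK x y hyx h' h
    have htrans : ∀ u y w, G.Adj u (σ y) → G.Adj y w → G.Adj u w := by
      intro u y w h h'
      refine hσ.adj_trans hG h h' ?_
      rintro rfl
      exact (hxor w y).1 h h'.symm
    obtain ⟨x₀⟩ := hconn.nonempty
    have hnn : ∀ y z, G.Adj x₀ y → G.Adj x₀ z → ¬ G.Adj y z := by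
      intro y z hy hz hyz
      exact (hxor x₀ z).1 (htrans x₀ (σ y) (σ z) (by rwa [hinv]) (hG σ hσ _ _ hyz)) hz
    have hdiff : ∀ y z, G.Adj x₀ y → ¬ G.Adj x₀ z → G.Adj y z := by
      intro y z hy hz
      by_contra hyz
      exact hnn y (σ z) hy ((hxor _ _).2 hz) ((hxor _ _).2 hyz)
    have hsame : ∀ y z, ¬ G.Adj x₀ y → ¬ G.Adj x₀ z → ¬ G.Adj y z := by
      intro y z hy hz hyz
      exact hz (htrans x₀ y z ((hxor _ _).2 hy) hyz)
    have heq : Fintype.card {v // G.Adj x₀ v} = Fintype.card {v // ¬ G.Adj x₀ v} :=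
      Fintype.card_congr <| Equiv.subtypeEquiv ⟨σ, σ, hinv, hinv⟩ fun v =>
        (not_iff_comm.1 (hxor x₀ v).symm).symm
    have hsum := Fintype.card_congr (Equiv.sumCompl fun v => G.Adj x₀ v)
    rw [Fintype.card_sum, hcard] at hsum
    let φ := (Equiv.sumCompl fun v => G.Adj x₀ v).symm.trans
      (Equiv.sumCongr (Fintype.equivFinOfCardEq (n := k + 1) (by omega))
        (Fintype.equivFinOfCardEq (n := k + 1) (by omega)))
    refine ⟨⟨φ, ?_⟩⟩
    intro a b
    by_cases ha : G.Adj x₀ a <;> by_cases hb : G.Adj x₀ b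
    · simp [φ, ha, hb, hnn a b ha hb]
    · simp [φ, ha, hb, hdiff a b ha hb]
    · simp [φ, ha, hb, (hdiff b a hb ha).symm]
    · simp [φ, ha, hb, hsame a b ha hb]
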